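/- arXiv:2510.25351 — 2 statements merged into one kernel-verified Lean document; each statement's English description precedes it below -/
import Mathlib

section
/- (Conservative form of the CIF coupling.) Let 0 < n_L < n_R be integers, let f_H : ℝ^{n_R} → ℝ^{n_R} be continuously differentiable, and let f_L : ℝ^{n_L} → ℝ^{n_L} satisfy the hierarchical property: for every w ∈ ℝ^{n_L}, the first n_L components of f_H((w, 0)) equal f_L(w). Let w_{L−1}, w_L ∈ ℝ^{n_L}, w_R, w_{R+1} ∈ ℝ^{n_R}, and s₀ ∈ (0,1). Define the interface linearization vectors A_{L−1/2} := f_L(w_L) − f_L(w_{L−1}), A_{R+1/2} := f_H(w_{R+1}) − f_H(w_R), and at the coupling interface A_{L+1/2} := ∫₀^{s₀} Df_H(Φ_low(s))·Φ_low′(s) ds + ∫_{s₀}^{1} Df_H(Φ_high(s))·Φ_high′(s) ds along the CIF piecewise path with data (w_L, w_R, s₀). Let V_{L−1/2} ∈ ℝ^{n_L} and V_{L+1/2}, V_{R+1/2} ∈ ℝ^{n_R} be arbitrary viscosity vectors, define fluctuations D^±_{L−1/2} := ½(A_{L−1/2} ± V_{L−1/2}), D^±_{R+1/2} := ½(A_{R+1/2}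 ± V_{R+1/2}), D^+_{L+1/2} := ½(A_{L+1/2} + V_{L+1/2}), and D^−_{L+1/2} := the first n_L components of ½(A_{L+1/2} − V_{L+1/2}). Then for any ν > 0, the finite-volume updates w_L′ := w_L − ν(D^+_{L−1/2} + D^−_{L+1/2}) and (w_R′)_{:n_L} := (w_R)_{:n_L} − ν((D^+_{L+1/2})_{:n_L} + (D^−_{R+1/2})_{:n_L}) can be written in conservative flux form by only modifying the flux at the coupling interface: w_L′ = w_L − ν(F̃ − F_{L−1/2}) and (w_R′)_{:n_L} = (w_R)_{:n_L} − ν(F_{R+1/2} − F̃), where F_{L−1/2} := ½(f_L(w_{L−1}) + f_L(w_L) − V_{L−1/2}), F̃ := ½(f_L(w_L) + (f_H(w_R))_{:n_L} − (V_{L+1/2})_{:n_L}), and F_{R+1/2} := ½((f_H(w_R))_{:n_L} + (f_H(w_{R+1}))_{:n_L} − (V_{R+1/2})_{:n_L}). -/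
/-- First `nL` components of a vector in `ℝ^{nL+m}`. -/
def firstC (nL m : ℕ) (v : Fin (nL + m) → ℝ) : Fin nL → ℝ := fun i => v (Fin.castAdd m i)

/-- Last `m` components of a vector in `ℝ^{nL+m}`. -/
def lastC (nL m : ℕ) (v : Fin (nL + m) → ℝ) : Fin m → ℝ := fun i => v (Fin.natAdd nL i)

/-- The CIF piecewise-path generalized Roe linearization along `Φ_low`, `Φ_high`. -/
noncomputable def cifLin (nL m : ℕ) (f : (Fin (nL + m) → ℝ) → (Fin (nL + m) → ℝ))
    (wL a : Fin nL → ℝ) (b : Fin m → ℝ) (s₀ : ℝ) : Fin (nL + m) → ℝ :=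
  (∫ s in (0:ℝ)..s₀,
      fderiv ℝ f (Fin.append ((s / s₀) • a + (1 - s / s₀) • wL) 0)
        (Fin.append ((1 / s₀) • (a - wL)) 0)) +
  ∫ s in s₀..(1:ℝ),
      fderiv ℝ f (Fin.append a (((s - s₀) / (1 - s₀)) • b))
        (Fin.append (0 : Fin nL → ℝ) ((1 / (1 - s₀)) • b))

theorem ftc_aux {n : ℕ} (f : (Fin n → ℝ) → (Fin n → ℝ)) (hf : ContDiff ℝ 1 f)
    (g : ℝ → Fin n → ℝ) (v : Fin n → ℝ) (hg : ∀ s, HasDerivAt g v s) (p q : ℝ) :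
    ∫ s in p..q, fderiv ℝ f (g s) v = f (g q) - f (g p) := by
  have hgc : Continuous g := continuous_iff_continuousAt.2 fun s => (hg s).continuousAt
  have hc : Continuous fun s => fderiv ℝ f (g s) v :=
    ((hf.continuous_fderiv one_ne_zero).comp hgc).clm_apply continuous_const
  refine intervalIntegral.integral_eq_sub_of_hasDerivAt (f := fun s => f (g s)) (fun s _ => ?_)
    (hc.intervalIntegrable _ _)
  exact ((hf.differentiable one_ne_zero) (g s)).hasFDerivAt.comp_hasDerivAt s (hg s)

theorem cifLin_eq (nL m : ℕ) (f : (Fin (nL + m) → ℝ) → (Fin (nL + m) → ℝ))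
    (hf : ContDiff ℝ 1 f) (wL a : Fin nL → ℝ) (b : Fin m → ℝ) (s₀ : ℝ)
    (hs₀ : s₀ ∈ Set.Ioo (0:ℝ) 1) :
    cifLin nL m f wL a b s₀ = f (Fin.append a b) - f (Fin.append wL 0) := by
  have h0 : s₀ ≠ 0 := hs₀.1.ne'
  have h1 : 1 - s₀ ≠ 0 := (sub_pos.2 hs₀.2).ne'
  unfold cifLin
  rw [ftc_aux f hf (fun s => Fin.append ((s / s₀) • a + (1 - s / s₀) • wL) 0),
    ftc_aux f hf (fun s => Fin.append a (((s - s₀) / (1 - s₀)) • b))]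
  · simp [h0, h1]
  · intro s
    rw [hasDerivAt_pi]
    intro i
    refine Fin.addCases (fun i => ?_) (fun i => ?_) i
    · simpa using hasDerivAt_const s (a i)
    · simpa using (((hasDerivAt_id s).sub_const s₀).div_const (1 - s₀)).mul_const (b i)
  · intro s
    rw [hasDerivAt_pi]
    intro i
    refine Fin.addCases (fun i => ?_) (fun i => ?_) i
    · have h := ((hasDerivAt_id s).div_const s₀)
      have h2 := (h.mul_const (a i)).add ((h.const_sub 1).mul_const (wL i))
      simp only [Fin.append_left]
      refine h2.congr_deriv ?_
      simp
      ring
    · simpa using hasDerivAt_const s (0:ℝ)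

/-- Conservative form of the CIF coupling: the finite-volume updates with
fluctuations `D^±` built from the interface linearizations `A_{L−1/2}`, `A_{L+1/2}`
(the CIF linearization) and `A_{R+1/2}` and arbitrary viscosity vectors can be
written in conservative flux form, modifying only the flux at the coupling interface. -/
theorem stmt2 (nL m : ℕ) (hnL : 0 < nL) (hm : 0 < m)
    (fH : (Fin (nL + m) → ℝ) → (Fin (nL + m) → ℝ)) (hfH : ContDiff ℝ 1 fH)
    (fL : (Fin nL → ℝ) → (Fin nL → ℝ))
    (hier : ∀ (w : Fin nL → ℝ) (i : Fin nL), fH (Fin.append w 0) (Fin.castAdd m i) = fL w i)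
    (wLm1 wL : Fin nL → ℝ) (wR wR1 : Fin (nL + m) → ℝ)
    (s₀ : ℝ) (hs₀ : s₀ ∈ Set.Ioo (0:ℝ) 1)
    (VLm : Fin nL → ℝ) (Vmid VRp : Fin (nL + m) → ℝ)
    (ν : ℝ) (hν : 0 < ν) :
    -- update of w_L:  w_L − ν (D⁺_{L−1/2} + D⁻_{L+1/2}) = w_L − ν (F̃ − F_{L−1/2})
    (wL - ν • ((1/2 : ℝ) • (fL wL - fL wLm1 + VLm) +
        (fun i => (1/2 : ℝ) *
          (cifLin nL m fH wL (firstC nL m wR) (lastC nL m wR) s₀ (Fin.castAdd m i) -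
            Vmid (Fin.castAdd m i))))
      = wL - ν • ((fun i => (1/2 : ℝ) *
            (fL wL i + fH wR (Fin.castAdd m i) - Vmid (Fin.castAdd m i))) -
          (1/2 : ℝ) • (fL wLm1 + fL wL - VLm))) ∧
    -- update of (w_R)_{:nL}: (w_R)_{:nL} − ν ((D⁺_{L+1/2})_{:nL} + (D⁻_{R+1/2})_{:nL})
    --                      = (w_R)_{:nL} − ν (F_{R+1/2} − F̃)
    (firstC nL m wR - ν • ((fun i => (1/2 : ℝ) *
          (cifLin nL m fH wL (firstC nL m wR) (lastC nL m wR) s₀ (Fin.castAdd m i) +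
            Vmid (Fin.castAdd m i))) +
        (fun i => (1/2 : ℝ) *
          (fH wR1 (Fin.castAdd m i) - fH wR (Fin.castAdd m i) - VRp (Fin.castAdd m i))))
      = firstC nL m wR - ν • ((fun i => (1/2 : ℝ) *
            (fH wR (Fin.castAdd m i) + fH wR1 (Fin.castAdd m i) - VRp (Fin.castAdd m i))) -
          (fun i => (1/2 : ℝ) *
            (fL wL i + fH wR (Fin.castAdd m i) - Vmid (Fin.castAdd m i))))) := by
  have key : ∀ i : Fin nL,
      cifLin nL m fH wL (firstC nL m wR) (lastC nL m wR) s₀ (Fin.castAdd m i)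
        = fH wR (Fin.castAdd m i) - fL wL i := by
    intro i
    have hw : Fin.append (firstC nL m wR) (lastC nL m wR) = wR := by
      funext j
      refine Fin.addCases (fun j => ?_) (fun j => ?_) j <;> simp [firstC, lastC]
    rw [cifLin_eq nL m fH hfH _ _ _ _ hs₀, hw, Pi.sub_apply, hier]
  constructor
  · funext i
    simp only [Pi.sub_apply, Pi.add_apply, Pi.smul_apply, smul_eq_mul, key]
    ring
  · funext i
    simp only [Pi.sub_apply, Pi.add_apply, Pi.smul_apply, smul_eq_mul, key]
    ring
end

section
/- (Hierarchical structure of the SWME system matrix.) Let M_L < M_H be natural numbers, g > 0, and let real coefficients A_{ijk}, B_{ijk} for 1 ≤ i, j, k ≤ M_H be given (the order-M_L system uses the restriction of these coefficients to indices ≤ M_L). For every w = (h, q, p₁, …, p_{M_L}) ∈ ℝ^{M_L+2} with h > 0, the submatrix consisting of the first M_L+2 rows and first M_L+2 columns of the order-M_H system matrix A_{M_H} evaluated at the padded state (h, q, p₁, …, p_{M_L}, 0, …, 0) ∈ ℝ^{M_H+2} equals the order-M_L system matrix A_{M_L}(w). -/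
noncomputable section

/-- The `k`-th coordinate of a vector, with value `0` out of range. -/
def get {n : ℕ} (w : Fin n → ℝ) (k : ℕ) : ℝ := if h : k < n then w ⟨k, h⟩ else 0

/-- Conservative flux `F_M` of the `M`-th order shallow water moment system in the
conserved variables `w = (h, q, p₁, …, p_M)`, with coefficients `Ac i j k = A_{ijk}`. -/
def swmeFlux (g : ℝ) (Ac : ℕ → ℕ → ℕ → ℝ) (M : ℕ) (w : Fin (M + 2) → ℝ) :
    Fin (M + 2) → ℝ := fun i =>
  if (i : ℕ) = 0 then get w 1
  else if (i : ℕ) = 1 then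
    (get w 1) ^ 2 / get w 0
      + (∑ k ∈ Finset.Icc 1 M, (get w (k + 1)) ^ 2 / ((2 * (k : ℝ) + 1) * get w 0))
      + g * (get w 0) ^ 2 / 2
  else
    2 * get w 1 * get w (i : ℕ) / get w 0
      + ∑ j ∈ Finset.Icc 1 M, ∑ k ∈ Finset.Icc 1 M,
          Ac ((i : ℕ) - 1) j k * get w (j + 1) * get w (k + 1) / get w 0

/-- Nonconservative matrix `Q_M` of the `M`-th order shallow water moment system, whose
only nonzero entries are `(Q_M)_{i+2,j+2} = u·δ_{ij} − ∑_{k=1}^M B_{ijk} α_k`. -/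
def swmeQ (Bc : ℕ → ℕ → ℕ → ℝ) (M : ℕ) (w : Fin (M + 2) → ℝ) :
    Matrix (Fin (M + 2)) (Fin (M + 2)) ℝ := Matrix.of fun i j =>
  if 2 ≤ (i : ℕ) ∧ 2 ≤ (j : ℕ) then
    (if (i : ℕ) = (j : ℕ) then get w 1 / get w 0 else 0)
      - ∑ k ∈ Finset.Icc 1 M, Bc ((i : ℕ) - 1) ((j : ℕ) - 1) k * (get w (k + 1) / get w 0)
  else 0

/-- System matrix `A_M(w) := J_{F_M}(w) − Q_M(w)` of the `M`-th order system. -/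
def swmeA (g : ℝ) (Ac Bc : ℕ → ℕ → ℕ → ℝ) (M : ℕ) (w : Fin (M + 2) → ℝ) :
    Matrix (Fin (M + 2)) (Fin (M + 2)) ℝ := Matrix.of fun i j =>
  fderiv ℝ (fun v => swmeFlux g Ac M v i) w (Pi.single j 1) - swmeQ Bc M w i j

/-- The padded state `(h, q, p₁, …, p_{M_L}, 0, …, 0) ∈ ℝ^{M_H+2}`. -/
def pad (ML MH : ℕ) (w : Fin (ML + 2) → ℝ) : Fin (MH + 2) → ℝ :=
  fun k => if hk : (k : ℕ) < ML + 2 then w ⟨k, hk⟩ else 0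

theorem get_pad {ML MH : ℕ} (hM : ML < MH) (w : Fin (ML + 2) → ℝ) (k : ℕ) :
    get (pad ML MH w) k = get w k := by
  unfold _root_.get pad
  by_cases h1 : k < ML + 2
  · have h2 : k < MH + 2 := by omega
    simp [h1, h2]
  · simp [h1]

theorem get_out {n : ℕ} (w : Fin n → ℝ) (k : ℕ) (hk : n ≤ k) : get w k = 0 := by
  unfold _root_.get
  rw [dif_neg (by omega)]

theorem differentiableAt_get {n : ℕ} (k : ℕ) (w : Fin n → ℝ) :
    DifferentiableAt ℝ (fun v : Fin n → ℝ => get v k) w := by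
  unfold _root_.get
  by_cases h : k < n
  · simp only [h, dif_pos]
    fun_prop
  · simp only [h, dif_neg, not_false_eq_true]
    fun_prop

theorem sum_trunc {ML MH : ℕ} (hM : ML < MH) (f : ℕ → ℝ) (hf : ∀ k, ML < k → f k = 0) :
    ∑ k ∈ Finset.Icc 1 MH, f k = ∑ k ∈ Finset.Icc 1 ML, f k := by
  symm
  apply Finset.sum_subset (Finset.Icc_subset_Icc le_rfl hM.le)
  intro x hx hx'
  simp only [Finset.mem_Icc] at hx hx'
  exact hf x (by omega)

theorem flux_pad {ML MH : ℕ} (hM : ML < MH) (g : ℝ) (Ac : ℕ → ℕ → ℕ → ℝ)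
    (w : Fin (ML + 2) → ℝ) (i : Fin (ML + 2)) (hle : ML + 2 ≤ MH + 2) :
    swmeFlux g Ac MH (pad ML MH w) (Fin.castLE hle i) = swmeFlux g Ac ML w i := by
  have h0 : ∀ k, ML < k → get w (k + 1) = 0 := fun k hk => get_out w _ (by omega)
  unfold swmeFlux
  simp only [get_pad hM, Fin.val_castLE]
  rw [sum_trunc hM (fun k => (get w (k + 1)) ^ 2 / ((2 * (k : ℝ) + 1) * get w 0))
    (fun k hk => by simp [h0 k hk])]
  rw [sum_trunc hM (fun j => ∑ k ∈ Finset.Icc 1 MH,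
    Ac ((i : ℕ) - 1) j k * get w (j + 1) * get w (k + 1) / get w 0)
    (fun k hk => by simp [h0 k hk])]
  have h2 : ∀ j, ∑ k ∈ Finset.Icc 1 MH,
      Ac ((i : ℕ) - 1) j k * get w (j + 1) * get w (k + 1) / get w 0 = ∑ k ∈ Finset.Icc 1 ML,
      Ac ((i : ℕ) - 1) j k * get w (j + 1) * get w (k + 1) / get w 0 := fun j =>
    sum_trunc hM _ (fun k hk => by simp [h0 k hk])
  simp only [h2]

theorem Q_pad {ML MH : ℕ} (hM : ML < MH) (Bc : ℕ → ℕ → ℕ → ℝ)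
    (w : Fin (ML + 2) → ℝ) (i j : Fin (ML + 2)) (hle : ML + 2 ≤ MH + 2) :
    swmeQ Bc MH (pad ML MH w) (Fin.castLE hle i) (Fin.castLE hle j) = swmeQ Bc ML w i j := by
  have h0 : ∀ k, ML < k → get w (k + 1) = 0 := fun k hk => get_out w _ (by omega)
  unfold swmeQ
  simp only [Matrix.of_apply, get_pad hM, Fin.val_castLE]
  rw [sum_trunc hM (fun k => Bc ((i : ℕ) - 1) ((j : ℕ) - 1) k * (get w (k + 1) / get w 0))
    (fun k hk => by simp [h0 k hk])]

theorem differentiableAt_quot {n : ℕ} {a b : (Fin n → ℝ) → ℝ} {w : Fin n → ℝ}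
    (ha : DifferentiableAt ℝ a w) (hb : DifferentiableAt ℝ b w) (h : b w ≠ 0) :
    DifferentiableAt ℝ (fun v => a v / b v) w := by
  simp only [div_eq_mul_inv]
  exact ha.fun_mul (hb.fun_inv h)

theorem differentiableAt_flux (g : ℝ) (Ac : ℕ → ℕ → ℕ → ℝ) (M : ℕ) (w : Fin (M + 2) → ℝ)
    (hw : get w 0 ≠ 0) (i : Fin (M + 2)) :
    DifferentiableAt ℝ (fun v => swmeFlux g Ac M v i) w := by
  have hd := fun k => differentiableAt_get k w
  unfold swmeFlux
  split_ifs
  · exact hd 1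
  · refine DifferentiableAt.fun_add (DifferentiableAt.fun_add ?_ ?_) ?_
    · have h := differentiableAt_quot (((hd 1).fun_pow 2)) (hd 0) (by exact hw)
      exact h
    · refine DifferentiableAt.fun_sum fun k _ => ?_
      have h := differentiableAt_quot (((hd (k + 1)).fun_pow 2)) ((hd 0).const_mul (2 * (k : ℝ) + 1))
        (by exact mul_ne_zero (by positivity) hw)
      exact h
    · have h := differentiableAt_quot (((hd 0).fun_pow 2).const_mul g)
        (differentiableAt_const (2 : ℝ)) two_ne_zero
      exact h
  · refine DifferentiableAt.fun_add ?_ ?_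
    · have h := differentiableAt_quot ((((hd 1).const_mul 2).fun_mul (hd i))) (hd 0) (by exact hw)
      exact h
    · refine DifferentiableAt.fun_sum fun j _ => DifferentiableAt.fun_sum fun k _ => ?_
      have h := differentiableAt_quot ((((hd (j + 1)).const_mul (Ac ((i : ℕ) - 1) j k)).fun_mul (hd (k + 1)))) (hd 0) (by exact hw)
      exact h

/-- Padding as a linear map. -/
def padLin (ML MH : ℕ) : (Fin (ML + 2) → ℝ) →ₗ[ℝ] (Fin (MH + 2) → ℝ) where
  toFun := pad ML MH
  map_add' x y := by
    ext k
    by_cases h : (k : ℕ) < ML + 2 <;> simp [pad, h]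
  map_smul' c x := by
    ext k
    by_cases h : (k : ℕ) < ML + 2 <;> simp [pad, h]

theorem pad_single {ML MH : ℕ} (j : Fin (ML + 2)) (hle : ML + 2 ≤ MH + 2) :
    pad ML MH (Pi.single j 1) = Pi.single (Fin.castLE hle j) 1 := by
  ext k
  unfold pad
  by_cases h : (k : ℕ) < ML + 2
  · simp [h, Pi.single_apply, Fin.ext_iff]
  · have : (k : ℕ) ≠ j := by have := j.2; omega
    simp [h, Pi.single_apply, Fin.ext_iff, this]

/-- Hierarchical structure of the SWME system matrix: the upper-left
`(M_L+2) × (M_L+2)` block of the order-`M_H` system matrix evaluated at the padded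
state equals the order-`M_L` system matrix. -/
theorem stmt8 (ML MH : ℕ) (hM : ML < MH) (g : ℝ) (hg : 0 < g)
    (Ac Bc : ℕ → ℕ → ℕ → ℝ) (w : Fin (ML + 2) → ℝ) (hw : 0 < get w 0)
    (i j : Fin (ML + 2)) :
    swmeA g Ac Bc MH (pad ML MH w) (Fin.castLE (by omega) i) (Fin.castLE (by omega) j) =
      swmeA g Ac Bc ML w i j := by
  have hle : ML + 2 ≤ MH + 2 := by omega
  have hne : get (pad ML MH w) 0 ≠ 0 := by
    rw [get_pad hM]
    exact hw.ne'
  have hF := (differentiableAt_flux g Ac MH (pad ML MH w) hne (Fin.castLE hle i)).hasFDerivAt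
  have hP : HasFDerivAt (pad ML MH) (LinearMap.toContinuousLinearMap (padLin ML MH)) w :=
    (LinearMap.toContinuousLinearMap (padLin ML MH)).hasFDerivAt
  have hc := (hF.comp w hP).fderiv
  have he : ((fun v => swmeFlux g Ac MH v (Fin.castLE hle i)) ∘ pad ML MH)
      = fun v => swmeFlux g Ac ML v i := by
    funext v
    exact flux_pad hM g Ac v i hle
  rw [he] at hc
  unfold swmeA
  simp only [Matrix.of_apply]
  rw [Q_pad hM, hc, ← pad_single j hle]
  rfl

end
end
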